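/- Let n ≥ 1, let Q be a symmetric positive definite n × n real matrix, let q, y ∈ ℝⁿ, and let C > 0. Let K = {μ ∈ ℝⁿ : 0 ≤ μ_i ≤ C for all i, and Σ_{i=1}^n y_i μ_i = 0}, and for each ε ∈ ℝ let μ(ε) be the unique minimizer over K of f_ε(μ) = ½ μᵀQμ − Σ_{i=1}^n μ_i + ε qᵀμ. Then there exists a finite set T ⊂ ℝ such that on every connected component I of ℝ ∖ T the index partition is stable: the three sets F(ε) = {i : μ_i(ε) = 0}, S(ε) = {i : 0 < μ_i(ε) < C}, and E(ε) = {i : μ_i(ε) = C} do not depend on ε for ε ∈ I. In particular, every ε ∉ T admits a neighborhood of perturbations Δε within which tightening or loosening the fairness parameter yields no change to the partition {F, S, E}. -/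

import Mathlib

open Matrix

/-- The dual feasible set: box constraints `0 ≤ μ_i ≤ C` and the equality
constraint `∑ i, y_i μ_i = 0`. -/
def DualFeasible (n : ℕ) (y : Fin n → ℝ) (C : ℝ) (μ : Fin n → ℝ) : Prop :=
  (∀ i, 0 ≤ μ i ∧ μ i ≤ C) ∧ ∑ i, y i * μ i = 0

/-- The parametric dual objective `f_ε(μ) = ½ μᵀQμ − ∑ μ_i + ε qᵀμ`. -/
noncomputable def dualObj (n : ℕ) (Q : Matrix (Fin n) (Fin n) ℝ) (q : Fin n → ℝ)
    (ε : ℝ) (μ : Fin n → ℝ) : ℝ :=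
  (1 / 2) * (μ ⬝ᵥ Q.mulVec μ) - ∑ i, μ i + ε * (q ⬝ᵥ μ)

open Filter Topology in
/-- A quadratic `s a + s² b` that is nonnegative for all small `s > 0` has `a ≥ 0`. -/
lemma nonneg_of_eventually_nonneg_quadratic {a b : ℝ}
    (h : ∀ᶠ s in 𝓝[>] (0 : ℝ), 0 ≤ s * a + s ^ 2 * b) : 0 ≤ a := by
  have hlim : Tendsto (fun s : ℝ => a + s * b) (𝓝[>] 0) (𝓝 a) := by
    have hcont : Continuous fun s : ℝ => a + s * b := by fun_prop
    simpa using (hcont.tendsto 0).mono_left nhdsWithin_le_nhds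
  refine ge_of_tendsto hlim ?_
  filter_upwards [h, self_mem_nhdsWithin] with s hs hs0
  have hs0 : 0 < s := hs0
  exact nonneg_of_mul_nonneg_right (by linarith : 0 ≤ s * (a + s * b)) hs0

/-- The gradient of the dual objective `dualObj n Q q ε` at `μ`. -/
def dualGrad (n : ℕ) (Q : Matrix (Fin n) (Fin n) ℝ) (q : Fin n → ℝ)
    (ε : ℝ) (μ : Fin n → ℝ) : Fin n → ℝ :=
  Q *ᵥ μ - 1 + ε • q

lemma dualObj_add {n : ℕ} {Q : Matrix (Fin n) (Fin n) ℝ} (hQ : Q.IsSymm) (q : Fin n → ℝ)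
    (ε : ℝ) (μ d : Fin n → ℝ) :
    dualObj n Q q ε (μ + d) =
      dualObj n Q q ε μ + dualGrad n Q q ε μ ⬝ᵥ d + (1 / 2) * (d ⬝ᵥ Q *ᵥ d) := by
  have hsymm : μ ⬝ᵥ Q *ᵥ d = d ⬝ᵥ Q *ᵥ μ := by
    rw [dotProduct_mulVec, ← mulVec_transpose, hQ.eq, dotProduct_comm]
  have hcomm : (Q *ᵥ μ) ⬝ᵥ d = d ⬝ᵥ Q *ᵥ μ := dotProduct_comm _ _
  simp only [dualObj, dualGrad, mulVec_add, dotProduct_add, add_dotProduct, sub_dotProduct,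
    smul_dotProduct, one_dotProduct, Pi.add_apply, Finset.sum_add_distrib, smul_eq_mul,
    hsymm, hcomm]
  ring

open Filter Topology in
/-- First-order necessary condition at a minimizer, along a feasible direction. -/
lemma dualGrad_dotProduct_nonneg {n : ℕ} {Q : Matrix (Fin n) (Fin n) ℝ} (hQ : Q.IsSymm)
    {q y : Fin n → ℝ} {C ε : ℝ} {μ d : Fin n → ℝ}
    (hmin : ∀ ν, DualFeasible n y C ν → dualObj n Q q ε μ ≤ dualObj n Q q ε ν)
    (hd : ∀ᶠ s in 𝓝[>] (0 : ℝ), DualFeasible n y C (μ + s • d)) :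
    0 ≤ dualGrad n Q q ε μ ⬝ᵥ d := by
  refine nonneg_of_eventually_nonneg_quadratic (b := (1 / 2) * (d ⬝ᵥ Q *ᵥ d)) ?_
  filter_upwards [hd] with s hs
  have h := hmin _ hs
  rw [dualObj_add hQ] at h
  simp only [mulVec_smul, dotProduct_smul, smul_dotProduct, smul_eq_mul] at h
  linarith

/-- First-order sufficient condition, with uniqueness of the minimizer. -/
lemma eq_of_dualGrad_dotProduct_nonneg {n : ℕ} {Q : Matrix (Fin n) (Fin n) ℝ}
    (hQ : Q.IsSymm) (hQpd : Q.PosDef) {q : Fin n → ℝ} {ε : ℝ} {μ ν : Fin n → ℝ}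
    (hle : dualObj n Q q ε μ ≤ dualObj n Q q ε ν)
    (hν : 0 ≤ dualGrad n Q q ε ν ⬝ᵥ (μ - ν)) : μ = ν := by
  by_contra hne
  have hpos : 0 < (μ - ν) ⬝ᵥ Q *ᵥ (μ - ν) := by
    simpa using hQpd.dotProduct_mulVec_pos (sub_ne_zero.mpr hne)
  have h := dualObj_add hQ q ε ν (μ - ν)
  rw [add_sub_cancel] at h
  linarith

lemma DualFeasible.lineMap {n : ℕ} {y : Fin n → ℝ} {C : ℝ} {μ ν : Fin n → ℝ}
    (hμ : DualFeasible n y C μ) (hν : DualFeasible n y C ν) {s : ℝ} (hs0 : 0 ≤ s)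
    (hs1 : s ≤ 1) : DualFeasible n y C (μ + s • (ν - μ)) := by
  refine ⟨fun i => ?_, ?_⟩
  · obtain ⟨h1, h2⟩ := hμ.1 i
    obtain ⟨h3, h4⟩ := hν.1 i
    simp only [Pi.add_apply, Pi.smul_apply, Pi.sub_apply, smul_eq_mul]
    constructor <;> nlinarith
  · have h1 := hμ.2
    have h2 := hν.2
    change y ⬝ᵥ μ = 0 at h1
    change y ⬝ᵥ ν = 0 at h2
    change y ⬝ᵥ (μ + s • (ν - μ)) = 0
    simp [dotProduct_add, dotProduct_sub, h1, h2]

open Filter Topology in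
/-- Two feasible points with the same active bounds: the segment joining them can be
prolonged slightly. -/
lemma DualFeasible.eventually_add_smul_sub {n : ℕ} {y : Fin n → ℝ} {C : ℝ} {μ ν : Fin n → ℝ}
    (hμ : DualFeasible n y C μ) (hν : DualFeasible n y C ν)
    (h0 : ∀ i, μ i = 0 → ν i = 0) (hC : ∀ i, μ i = C → ν i = C) :
    ∀ᶠ s in 𝓝 (0 : ℝ), DualFeasible n y C (μ + s • (ν - μ)) := by
  have hbox : ∀ᶠ s in 𝓝 (0 : ℝ), ∀ i, 0 ≤ (μ + s • (ν - μ)) i ∧ (μ + s • (ν - μ)) i ≤ C := by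
    refine eventually_all.mpr fun i => ?_
    have hlim : Tendsto (fun s : ℝ => (μ + s • (ν - μ)) i) (𝓝 0) (𝓝 (μ i)) := by
      have hcont : Continuous fun s : ℝ => μ i + s * (ν i - μ i) := by fun_prop
      simpa using hcont.tendsto 0
    refine Eventually.and ?_ ?_
    · rcases (hμ.1 i).1.eq_or_lt' with h | h
      · simp [h, h0 i h]
      · exact (hlim.eventually_const_lt h).mono fun _ => le_of_lt
    · rcases (hμ.1 i).2.eq_or_lt with h | h
      · simp [h, hC i h]
      · exact (hlim.eventually_lt_const h).mono fun _ => le_of_lt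
  filter_upwards [hbox] with s hs
  refine ⟨hs, ?_⟩
  have h1 := hμ.2
  have h2 := hν.2
  change y ⬝ᵥ μ = 0 at h1
  change y ⬝ᵥ ν = 0 at h2
  change y ⬝ᵥ (μ + s • (ν - μ)) = 0
  simp [dotProduct_add, dotProduct_sub, h1, h2]

open Filter Topology in
lemma dualGrad_dotProduct_sub_eq_zero {n : ℕ} {Q : Matrix (Fin n) (Fin n) ℝ} (hQ : Q.IsSymm)
    {q y : Fin n → ℝ} {C ε : ℝ} {μ ν : Fin n → ℝ}
    (hμ : DualFeasible n y C μ) (hν : DualFeasible n y C ν)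
    (hmin : ∀ w, DualFeasible n y C w → dualObj n Q q ε μ ≤ dualObj n Q q ε w)
    (h0 : ∀ i, μ i = 0 → ν i = 0) (hC : ∀ i, μ i = C → ν i = C) :
    dualGrad n Q q ε μ ⬝ᵥ (ν - μ) = 0 := by
  have hev := hμ.eventually_add_smul_sub hν h0 hC
  have hneg : Tendsto (fun s : ℝ => -s) (𝓝 0) (𝓝 0) := by
    simpa using (continuous_neg.tendsto (0 : ℝ))
  have h1 := dualGrad_dotProduct_nonneg hQ hmin (hev.filter_mono nhdsWithin_le_nhds)
  have h2 := dualGrad_dotProduct_nonneg (d := -(ν - μ)) hQ hmin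
    (((hneg.eventually hev).filter_mono nhdsWithin_le_nhds).mono fun s hs => by
      rwa [smul_neg, ← neg_smul])
  rw [dotProduct_neg] at h2
  linarith

open Filter Topology in
lemma dualGrad_dotProduct_sub_nonneg {n : ℕ} {Q : Matrix (Fin n) (Fin n) ℝ} (hQ : Q.IsSymm)
    {q y : Fin n → ℝ} {C ε : ℝ} {μ ν : Fin n → ℝ}
    (hμ : DualFeasible n y C μ) (hν : DualFeasible n y C ν)
    (hmin : ∀ w, DualFeasible n y C w → dualObj n Q q ε μ ≤ dualObj n Q q ε w) :
    0 ≤ dualGrad n Q q ε μ ⬝ᵥ (ν - μ) := by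
  refine dualGrad_dotProduct_nonneg hQ hmin ?_
  filter_upwards [Ioo_mem_nhdsGT (zero_lt_one' ℝ)] with s hs
  exact hμ.lineMap hν hs.1.le hs.2.le

/-- Between two parameters whose minimizers have the same active bounds, the minimizer is the
corresponding convex combination. -/
lemma minimizer_eq_lineMap {n : ℕ} {Q : Matrix (Fin n) (Fin n) ℝ} (hQ : Q.IsSymm)
    (hQpd : Q.PosDef) {q y : Fin n → ℝ} {C : ℝ} {μpath : ℝ → (Fin n → ℝ)}
    (hopt : ∀ ε : ℝ, DualFeasible n y C (μpath ε) ∧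
      ∀ ν, DualFeasible n y C ν → dualObj n Q q ε (μpath ε) ≤ dualObj n Q q ε ν)
    {ε₀ ε₁ t : ℝ} (h0 : ∀ i, μpath ε₀ i = 0 ↔ μpath ε₁ i = 0)
    (hC : ∀ i, μpath ε₀ i = C ↔ μpath ε₁ i = C) (ht0 : 0 ≤ t) (ht1 : t ≤ 1) :
    μpath (ε₀ + t * (ε₁ - ε₀)) = μpath ε₀ + t • (μpath ε₁ - μpath ε₀) := by
  obtain ⟨hf₀, hm₀⟩ := hopt ε₀
  obtain ⟨hf₁, hm₁⟩ := hopt ε₁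
  obtain ⟨hf, hm⟩ := hopt (ε₀ + t * (ε₁ - ε₀))
  refine eq_of_dualGrad_dotProduct_nonneg hQ hQpd (hm _ (hf₀.lineMap hf₁ ht0 ht1)) ?_
  have e₀ := dualGrad_dotProduct_sub_eq_zero hQ hf₀ hf₁ hm₀ (fun i => (h0 i).1) fun i => (hC i).1
  have e₁ := dualGrad_dotProduct_sub_eq_zero hQ hf₁ hf₀ hm₁ (fun i => (h0 i).2) fun i => (hC i).2
  have p₀ := dualGrad_dotProduct_sub_nonneg hQ hf₀ hf hm₀
  have p₁ := dualGrad_dotProduct_sub_nonneg hQ hf₁ hf hm₁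
  have hgrad : dualGrad n Q q (ε₀ + t * (ε₁ - ε₀)) (μpath ε₀ + t • (μpath ε₁ - μpath ε₀)) =
      (1 - t) • dualGrad n Q q ε₀ (μpath ε₀) + t • dualGrad n Q q ε₁ (μpath ε₁) := by
    simp only [dualGrad, mulVec_add, mulVec_smul, mulVec_sub]
    module
  rw [hgrad]
  set g₀ := dualGrad n Q q ε₀ (μpath ε₀)
  set g₁ := dualGrad n Q q ε₁ (μpath ε₁)
  simp only [add_dotProduct, smul_dotProduct, dotProduct_sub, dotProduct_add, dotProduct_smul,
    smul_eq_mul] at e₀ e₁ p₀ p₁ ⊢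
  rw [sub_eq_zero] at e₀ e₁
  rw [e₀, e₁]
  nlinarith [mul_nonneg (sub_nonneg.2 ht1) p₀, mul_nonneg ht0 p₁]

/-- A convex combination of two points of `[a, b]`, both at `b` or both not at `b`. -/
lemma add_mul_sub_eq_iff_of_le {b u v t : ℝ} (hu : u ≤ b) (hv : v ≤ b) (h : u = b ↔ v = b)
    (ht0 : 0 ≤ t) (ht1 : t ≤ 1) : u + t * (v - u) = b ↔ u = b := by
  refine ⟨fun hb => ?_, fun hb => by rw [h.1 hb, hb]; ring⟩
  by_contra hne
  have hu' := lt_of_le_of_ne hu hne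
  have hv' := lt_of_le_of_ne hv (mt h.2 hne)
  rcases ht0.eq_or_lt with rfl | ht
  · exact hne (by simpa using hb)
  · nlinarith [mul_nonneg (sub_nonneg.2 ht1) (sub_nonneg.2 hu), mul_pos ht (sub_pos.2 hv')]

lemma Set.OrdConnected.mem_of_sSup_notMem_Icc {A : Set ℝ} (hA : A.OrdConnected) {a b : ℝ}
    (ha : a ∈ A) (hab : a ≤ b) (h : sSup A ∉ Set.Icc a b) : b ∈ A := by
  by_contra hb
  have hub : b ∈ upperBounds A := fun x hx =>
    le_of_not_gt fun hbx => hb (hA.out ha hx ⟨hab, hbx.le⟩)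
  exact h ⟨le_csSup ⟨b, hub⟩ ha, csSup_le ⟨a, ha⟩ hub⟩

/-- **stable partitions.** Along the minimizer path `ε ↦ μ(ε)` of the
parametric quadratic program, there is a finite set `T ⊂ ℝ` of breakpoints such that on
every connected component of `ℝ \ T` the index partition into free vectors
`F = {i : μ_i = 0}`, margin support vectors `S = {i : 0 < μ_i < C}`, and error vectors
`E = {i : μ_i = C}` is constant. -/
theorem parametric_qp_stable_partition
    (n : ℕ) (hn : 1 ≤ n)
    (Q : Matrix (Fin n) (Fin n) ℝ) (hQsymm : Q.IsSymm) (hQpd : Q.PosDef)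
    (q y : Fin n → ℝ) (C : ℝ) (hC : 0 < C)
    (μpath : ℝ → (Fin n → ℝ))
    (hopt : ∀ ε : ℝ,
      DualFeasible n y C (μpath ε) ∧
      ∀ ν : Fin n → ℝ, DualFeasible n y C ν →
        dualObj n Q q ε (μpath ε) ≤ dualObj n Q q ε ν) :
    ∃ T : Finset ℝ, ∀ ε₀ ε₁ : ℝ, ε₀ ≤ ε₁ → (∀ t ∈ T, t ∉ Set.Icc ε₀ ε₁) →
      ∀ i : Fin n,
        (μpath ε₀ i = 0 ↔ μpath ε₁ i = 0) ∧
        ((0 < μpath ε₀ i ∧ μpath ε₀ i < C) ↔ (0 < μpath ε₁ i ∧ μpath ε₁ i < C)) ∧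
        (μpath ε₀ i = C ↔ μpath ε₁ i = C) := by
  let A : Set (Fin n) × Set (Fin n) → Set ℝ := fun P =>
    {ε | ∀ i, (μpath ε i = 0 ↔ i ∈ P.1) ∧ (μpath ε i = C ↔ i ∈ P.2)}
  have hconn (P) : (A P).OrdConnected := by
    refine ⟨fun a ha b hb x hx i => ?_⟩
    rcases (hx.1.trans hx.2).eq_or_lt with rfl | hab
    · rw [← le_antisymm hx.1 hx.2]
      exact ha i
    have h0 i : μpath a i = 0 ↔ μpath b i = 0 := (ha i).1.trans (hb i).1.symm
    have hC' i : μpath a i = C ↔ μpath b i = C := (ha i).2.trans (hb i).2.symm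
    have hba := sub_pos.2 hab
    set t := (x - a) / (b - a) with ht
    have ht0 : 0 ≤ t := div_nonneg (sub_nonneg.2 hx.1) hba.le
    have ht1 : t ≤ 1 := (div_le_one hba).2 (by linarith [hx.2])
    have hxt : a + t * (b - a) = x := by rw [ht, div_mul_cancel₀ _ hba.ne']; ring
    have hpath := congrFun (minimizer_eq_lineMap hQsymm hQpd hopt h0 hC' ht0 ht1) i
    rw [hxt] at hpath
    simp only [Pi.add_apply, Pi.smul_apply, Pi.sub_apply, smul_eq_mul] at hpath
    obtain ⟨ha0, haC⟩ := (hopt a).1.1 i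
    obtain ⟨hb0, hbC⟩ := (hopt b).1.1 i
    rw [← (ha i).1, ← (ha i).2, hpath, add_mul_sub_eq_iff_of_le haC hbC (hC' i) ht0 ht1]
    refine ⟨?_, Iff.rfl⟩
    have hneg := add_mul_sub_eq_iff_of_le (neg_nonpos.2 ha0) (neg_nonpos.2 hb0)
      (by simpa using h0 i) ht0 ht1
    rw [neg_eq_zero] at hneg
    rw [← hneg, ← neg_eq_zero]
    ring_nf
  refine ⟨(Set.finite_range fun P => sSup (A P)).toFinset, fun ε₀ ε₁ hle hT i => ?_⟩
  have hmem : ε₁ ∈ A ({i | μpath ε₀ i = 0}, {i | μpath ε₀ i = C}) :=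
    (hconn _).mem_of_sSup_notMem_Icc (fun i => ⟨Iff.rfl, Iff.rfl⟩) hle (hT _ (by simp))
  have h0 : μpath ε₁ i = 0 ↔ μpath ε₀ i = 0 := (hmem i).1
  have hC' : μpath ε₁ i = C ↔ μpath ε₀ i = C := (hmem i).2
  have hS (ε) : (0 < μpath ε i ∧ μpath ε i < C) ↔ (μpath ε i ≠ 0 ∧ μpath ε i ≠ C) := by
    obtain ⟨h1, h2⟩ := (hopt ε).1.1 i
    exact and_congr h1.lt_iff_ne' h2.lt_iff_ne
  refine ⟨h0.symm, ?_, hC'.symm⟩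
  rw [hS, hS, Ne, Ne, Ne, Ne, h0, hC']
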